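/- arXiv:2512.14072 — 2 statements merged into one kernel-verified Lean document; each statement's English description precedes it below -/
import Mathlib

section
/- The path cost c : Ω → [0,∞] is lower semicontinuous on the path space Ω. -/
open MeasureTheory Filter Topology Set
open scoped ENNReal Classical

/-- The hierarchical-jump path cost: for a path `ω` in `Ω = ∏ k, Y k`, where `D k` is the
(possibly empty) set consisting of the isolated point `∂ₖ` of the augmented space `X̂ₖ = Y k`,
the cost is the sum of `c i j (ω i) (ω j)` over consecutive pairs `i < j` of active indices
(those `k` with `ω k ∉ D k`), i.e. pairs of active indices with no active index in between. -/
noncomputable def pathCost {K : ℕ} {Y : Fin (K + 1) → Type*} (D : ∀ k, Set (Y k))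
    (c : ∀ i j : Fin (K + 1), Y i → Y j → ℝ≥0∞) (ω : ∀ k, Y k) : ℝ≥0∞ :=
  ∑ i : Fin (K + 1), ∑ j : Fin (K + 1),
    if i < j ∧ ω i ∉ D i ∧ ω j ∉ D j ∧ ∀ m, i < m → m < j → ω m ∈ D m then
      c i j (ω i) (ω j)
    else 0

/-- The path cost `c : Ω → [0,∞]` is lower semicontinuous on the path space
`Ω = ∏_{k=0}^K X̂ₖ`, where the `X̂ₖ` are Polish, each intermediate space has an isolated added
point `∂ₖ` (modelled by the open subsingleton `D k`, empty for `k = 0, K`), and the pairwise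
costs `c i j` are lower semicontinuous on `Xᵢ × Xⱼ` (the active parts). -/
theorem pathCost_lowerSemicontinuous {K : ℕ} (hK : 1 ≤ K)
    (Y : Fin (K + 1) → Type*) [∀ k, TopologicalSpace (Y k)] [∀ k, PolishSpace (Y k)]
    (D : ∀ k, Set (Y k))
    (hDopen : ∀ k, IsOpen (D k)) (hDsub : ∀ k, (D k).Subsingleton)
    (hD0 : D 0 = ∅) (hDK : D (Fin.last K) = ∅)
    (c : ∀ i j : Fin (K + 1), Y i → Y j → ℝ≥0∞)
    (hc : ∀ i j : Fin (K + 1), i < j →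
      LowerSemicontinuousOn (fun p : Y i × Y j => c i j p.1 p.2) ((D i)ᶜ ×ˢ (D j)ᶜ)) :
    LowerSemicontinuous (pathCost D c) := by
  have hD (k : Fin (K + 1)) : IsClopen (D k) := ⟨(hDsub k).isClosed, hDopen k⟩
  unfold pathCost
  refine lowerSemicontinuous_sum fun i _ ↦ lowerSemicontinuous_sum fun j _ ω ↦ ?_
  have hactive : ∀ᶠ ω' in 𝓝 ω, ∀ k, ω' k ∈ D k ↔ ω k ∈ D k := by
    refine eventually_all.2 fun k ↦ ?_
    by_cases hk : ω k ∈ D k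
    · filter_upwards [(continuous_apply k).continuousAt ((hD k).isOpen.mem_nhds hk)] with ω' h
      exact iff_of_true h hk
    · filter_upwards [(continuous_apply k).continuousAt ((hD k).compl.isOpen.mem_nhds hk)]
        with ω' h
      exact iff_of_false h hk
  intro y hy
  split_ifs at hy with h
  · have hpair : Tendsto (fun ω' : ∀ k, Y k ↦ (ω' i, ω' j)) (𝓝 ω)
        (𝓝[(D i)ᶜ ×ˢ (D j)ᶜ] (ω i, ω j)) := by
      refine tendsto_nhdsWithin_iff.2
        ⟨((continuous_apply i).prodMk (continuous_apply j)).continuousAt, ?_⟩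
      filter_upwards [hactive] with ω' hω'
      exact ⟨fun hi ↦ h.2.1 ((hω' i).1 hi), fun hj ↦ h.2.2.1 ((hω' j).1 hj)⟩
    filter_upwards [hactive, hpair (hc i j h.1 (ω i, ω j) ⟨h.2.1, h.2.2.1⟩ y hy)] with ω' hω' hlt
    simpa only [hω', if_pos h, mem_preimage, mem_ofPred_eq] using hlt
  · exact absurd hy not_lt_zero
end

section
/- Fix μ_0 ∈ P(X_0) and μ_K ∈ P(X_K). If there exist intermediate measures μ_k ∈ P(X̂_k) for k = 1, …, K−1 such that Σ_{i=0}^{K−1} C̃_{i,i+1}(μ_i, μ_{i+1}) < ∞, where C̃_{i,i+1}(μ_i, μ_{i+1}) := inf_{π_i ∈ Π(μ_i, μ_{i+1})} ∫_{X̂_i × X̂_{i+1}} c̃_{i,i+1}(x̂_i, x̂_{i+1}) dπ_i, then the optimal value M of the hierarchical jump multi-marginal transport problem is finite. -/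
open MeasureTheory Filter Topology Set
open scoped ENNReal NNReal Classical

/-- The maximum adjacent cost `c̃_{i,i+1}`: equal to `c_{i,i+1}(x̂ᵢ, x̂_{i+1})` if both points
are active, to `sup {c_{i,j}(x̂ᵢ, x̂ⱼ) : i+1 < j ≤ K, x̂ⱼ ∈ Xⱼ}` if `x̂ᵢ` is active and
`x̂_{i+1} = ∂_{i+1}`, and to `0` otherwise. -/
noncomputable def maxAdjCost {K : ℕ} {Y : Fin (K + 1) → Type*} (D : ∀ k, Set (Y k))
    (c : ∀ i j : Fin (K + 1), Y i → Y j → ℝ≥0∞) (i : Fin K)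
    (x : Y i.castSucc) (y : Y i.succ) : ℝ≥0∞ :=
  if x ∉ D i.castSucc ∧ y ∉ D i.succ then c i.castSucc i.succ x y
  else if x ∉ D i.castSucc ∧ y ∈ D i.succ then
    ⨆ (j : Fin (K + 1)) (_ : i.succ < j) (z : Y j) (_ : z ∉ D j), c i.castSucc j x z
  else 0

/-- The two-marginal optimal transport cost `inf_{γ ∈ Π(μ,ν)} ∫ cost dγ`. -/
noncomputable def otCost {A B : Type*} [MeasurableSpace A] [MeasurableSpace B]
    (cost : A → B → ℝ≥0∞) (μ : Measure A) (ν : Measure B) : ℝ≥0∞ :=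
  ⨅ (γ : Measure (A × B)) (_ : γ.map Prod.fst = μ) (_ : γ.map Prod.snd = ν),
    ∫⁻ p, cost p.1 p.2 ∂γ

/-- The optimal value `M` of the hierarchical jump multi-marginal transport problem:
the infimum, over intermediate probability measures `μₖ ∈ P(X̂ₖ)` (`1 ≤ k ≤ K−1`) and
couplings `π ∈ Π(μ₀, …, μ_K)`, of `∫ c dπ`; equivalently, the infimum of `∫ c dπ` over
probability measures `π` on `Ω` with `(T₀)_# π = μ₀` and `(T_K)_# π = μ_K`. -/
noncomputable def hjmotValue {K : ℕ} {Y : Fin (K + 1) → Type*}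
    [∀ k, MeasurableSpace (Y k)] (D : ∀ k, Set (Y k))
    (c : ∀ i j : Fin (K + 1), Y i → Y j → ℝ≥0∞)
    (μ0 : Measure (Y 0)) (μK : Measure (Y (Fin.last K))) : ℝ≥0∞ :=
  ⨅ (π : Measure (∀ k, Y k)) (_ : IsProbabilityMeasure π)
    (_ : π.map (fun ω => ω 0) = μ0) (_ : π.map (fun ω => ω (Fin.last K)) = μK),
    ∫⁻ ω, pathCost D c ω ∂π

/-- A lower semicontinuous function on a measurable set, extended by `0`, is measurable. -/
theorem LowerSemicontinuousOn.measurable_indicator {A : Type*} [TopologicalSpace A]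
    [MeasurableSpace A] [OpensMeasurableSpace A] {f : A → ℝ≥0∞} {s : Set A}
    (hf : LowerSemicontinuousOn f s) (hs : MeasurableSet s) : Measurable (s.indicator f) := by
  refine measurable_of_Ioi fun a => ?_
  obtain ⟨u, hu, hsu⟩ := lowerSemicontinuousOn_iff_preimage_Ioi.1 hf a
  have : s.indicator f ⁻¹' Ioi a = s ∩ u := by
    rw [← hsu]
    ext x
    by_cases hx : x ∈ s <;> simp [hx]
  rw [this]
  exact hs.inter hu.measurableSet

theorem measurable_maxAdjCost {K : ℕ} {Y : Fin (K + 1) → Type*} [∀ k, TopologicalSpace (Y k)]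
    [∀ k, SecondCountableTopology (Y k)] [∀ k, MeasurableSpace (Y k)] [∀ k, BorelSpace (Y k)]
    {D : ∀ k, Set (Y k)} (hD : ∀ k, MeasurableSet (D k))
    {c : ∀ i j : Fin (K + 1), Y i → Y j → ℝ≥0∞}
    (hc : ∀ i j : Fin (K + 1), i < j →
      LowerSemicontinuousOn (fun p : Y i × Y j => c i j p.1 p.2) ((D i)ᶜ ×ˢ (D j)ᶜ))
    (i : Fin K) :
    Measurable fun p : Y i.castSucc × Y i.succ => maxAdjCost D c i p.1 p.2 := by
  have hjump : LowerSemicontinuousOn (fun x : Y i.castSucc =>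
      ⨆ (j : Fin (K + 1)) (_ : i.succ < j) (z : Y j) (_ : z ∉ D j), c i.castSucc j x z)
      (D i.castSucc)ᶜ := by
    refine lowerSemicontinuousOn_iSup fun j => lowerSemicontinuousOn_iSup fun hj =>
      lowerSemicontinuousOn_iSup fun z => lowerSemicontinuousOn_iSup fun hz => ?_
    exact (hc i.castSucc j (i.castSucc_lt_succ.trans hj)).comp
      (f := fun p : Y i.castSucc × Y j => c i.castSucc j p.1 p.2)
      (g := fun x => (x, z)) (by fun_prop) fun x hx => ⟨hx, hz⟩
  have hstep := (hc i.castSucc i.succ i.castSucc_lt_succ).measurable_indicator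
    ((hD _).compl.prod (hD _).compl)
  convert hstep.add (((hjump.measurable_indicator (hD _).compl).comp measurable_fst).indicator
    (measurable_snd (hD i.succ))) using 2 with p
  by_cases h1 : p.1 ∈ D i.castSucc <;> by_cases h2 : p.2 ∈ D i.succ <;>
    simp [maxAdjCost, h1, h2, indicator]

theorem pathCost_le_sum_maxAdjCost {K : ℕ} {Y : Fin (K + 1) → Type*} (D : ∀ k, Set (Y k))
    (c : ∀ i j : Fin (K + 1), Y i → Y j → ℝ≥0∞) (ω : ∀ k, Y k) :
    pathCost D c ω ≤ ∑ i : Fin K, maxAdjCost D c i (ω i.castSucc) (ω i.succ) := by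
  unfold pathCost
  rw [Fin.sum_univ_castSucc]
  have hlast : (∑ j : Fin (K + 1), if Fin.last K < j ∧ ω (Fin.last K) ∉ D (Fin.last K) ∧
      ω j ∉ D j ∧ ∀ m, Fin.last K < m → m < j → ω m ∈ D m then
        c (Fin.last K) j (ω (Fin.last K)) (ω j) else 0) = 0 :=
    Finset.sum_eq_zero fun j _ => if_neg fun h => absurd h.1 (Fin.le_last j).not_gt
  rw [hlast, add_zero]
  refine Finset.sum_le_sum fun i _ => ?_
  by_cases hex : ∃ j : Fin (K + 1), i.castSucc < j ∧ ω i.castSucc ∉ D i.castSucc ∧ ω j ∉ D j ∧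
      ∀ m, i.castSucc < m → m < j → ω m ∈ D m
  · obtain ⟨j, hj⟩ := hex
    obtain ⟨hij, hi, hjD, hbetween⟩ := id hj
    rw [Finset.sum_eq_single_of_mem j (Finset.mem_univ j), if_pos hj]
    · rcases (Fin.castSucc_lt_iff_succ_le.1 hij).eq_or_lt with rfl | hlt
      · simp [maxAdjCost, hi, hjD]
      · have hD := hbetween i.succ i.castSucc_lt_succ hlt
        simp only [maxAdjCost, hi, hD, not_true_eq_false, not_false_eq_true, and_false, and_true,
          if_false, if_true]
        exact le_iSup₂_of_le j hlt (le_iSup₂_of_le (ω j) hjD le_rfl)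
    · intro k _ hkj
      refine if_neg ?_
      rintro ⟨hik, -, hkD, hk⟩
      rcases lt_or_gt_of_ne hkj with h | h
      · exact hkD (hbetween k hik h)
      · exact hjD (hk j hij h)
  · push Not at hex
    rw [Finset.sum_eq_zero fun j _ => if_neg fun h => ?_]
    · exact zero_le
    · obtain ⟨m, h1, h2, h3⟩ := hex j h.1 h.2.1 h.2.2.1
      exact h3 (h.2.2.2 m h1 h2)

open scoped ProbabilityTheory in
/-- Resampling one coordinate of a random family from another one, so as to prescribe the joint
law of the two. -/
theorem exists_map_pair_eq_of_marginal {ι : Type*} [DecidableEq ι] {Y : ι → Type*}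
    [∀ k, MeasurableSpace (Y k)] {a b : ι} (hab : a ≠ b) [StandardBorelSpace (Y b)]
    (π : Measure (∀ k, Y k)) [IsProbabilityMeasure π]
    (γ : Measure (Y a × Y b)) (hγ : γ.map Prod.fst = π.map fun ω => ω a) :
    ∃ π' : Measure (∀ k, Y k), IsProbabilityMeasure π' ∧
      π'.map (fun ω => (ω a, ω b)) = γ ∧
      ∀ {Z : Type _} [MeasurableSpace Z] (f : (∀ k, Y k) → Z), Measurable f →
        (∀ ω y, f (Function.update ω b y) = f ω) → π'.map f = π.map f := by
  have : Nonempty (Y b) := by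
    obtain ⟨ω⟩ := nonempty_of_isProbabilityMeasure π
    exact ⟨ω b⟩
  have : IsProbabilityMeasure γ := by
    have : IsProbabilityMeasure (γ.map Prod.fst) := by
      rw [hγ]
      exact Measure.isProbabilityMeasure_map (measurable_pi_apply a).aemeasurable
    exact Measure.isProbabilityMeasure_of_map Prod.fst
  have hupd : Measurable fun p : (∀ k, Y k) × Y b => Function.update p.1 b p.2 :=
    measurable_update'
  set κ := γ.condKernel.comap (fun ω : ∀ k, Y k => ω a) (measurable_pi_apply a) with hκ
  refine ⟨(π ⊗ₘ κ).map fun p => Function.update p.1 b p.2,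
    Measure.isProbabilityMeasure_map hupd.aemeasurable, ?_, ?_⟩
  · rw [Measure.map_map (by fun_prop) hupd]
    have hfun : ((fun ω : ∀ k, Y k => (ω a, ω b)) ∘
        fun p : (∀ k, Y k) × Y b => Function.update p.1 b p.2) = fun p => (p.1 a, p.2) := by
      ext p <;> simp [hab]
    rw [hfun]
    conv_rhs => rw [← γ.disintegrate γ.condKernel]
    ext s hs
    have hm : Measurable fun p : (∀ k, Y k) × Y b => (p.1 a, p.2) := by fun_prop
    rw [Measure.map_apply hm hs, Measure.compProd_apply (hm hs), Measure.compProd_apply hs,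
      Measure.fst, hγ, lintegral_map (ProbabilityTheory.Kernel.measurable_kernel_prodMk_left hs)
        (measurable_pi_apply a)]
    rfl
  · intro Z _ f hf hfb
    rw [Measure.map_map hf hupd]
    have hfun : (f ∘ fun p : (∀ k, Y k) × Y b => Function.update p.1 b p.2) = f ∘ Prod.fst := by
      ext p
      exact hfb _ _
    rw [hfun, ← Measure.map_map hf measurable_fst]
    congr 1
    exact Measure.fst_compProd π κ

/-- Gluing lemma: couplings of consecutive marginals come from a joint law. -/
theorem exists_isProbabilityMeasure_map_pair_eq {K : ℕ} {Y : Fin (K + 1) → Type*}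
    [∀ k, MeasurableSpace (Y k)] [∀ k, StandardBorelSpace (Y k)]
    (μ : ∀ k, Measure (Y k)) [∀ k, IsProbabilityMeasure (μ k)]
    (γ : ∀ i : Fin K, Measure (Y i.castSucc × Y i.succ))
    (hfst : ∀ i, (γ i).map Prod.fst = μ i.castSucc) (hsnd : ∀ i, (γ i).map Prod.snd = μ i.succ) :
    ∃ π : Measure (∀ k, Y k), IsProbabilityMeasure π ∧ (∀ k, π.map (fun ω => ω k) = μ k) ∧
      ∀ i : Fin K, π.map (fun ω => (ω i.castSucc, ω i.succ)) = γ i := by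
  suffices h : ∀ n : ℕ, n ≤ K → ∃ π : Measure (∀ k, Y k), IsProbabilityMeasure π ∧
      (∀ k, π.map (fun ω => ω k) = μ k) ∧
      ∀ i : Fin K, i.val < n → π.map (fun ω => (ω i.castSucc, ω i.succ)) = γ i by
    obtain ⟨π, h1, h2, h3⟩ := h K le_rfl
    exact ⟨π, h1, h2, fun i => h3 i i.isLt⟩
  intro n
  induction n with
  | zero =>
    exact fun _ => ⟨Measure.pi μ, inferInstance,
      fun k => (measurePreserving_eval μ k).map_eq, fun i hi => absurd hi (Nat.not_lt_zero _)⟩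
  | succ n ih =>
    intro hn
    obtain ⟨π, hπ, hmarg, hpair⟩ := ih (by omega)
    let a : Fin K := ⟨n, hn⟩
    obtain ⟨π', hπ', hnew, hold⟩ := exists_map_pair_eq_of_marginal
      (a.castSucc_lt_succ.ne) π (γ a) ((hfst a).trans (hmarg _).symm)
    refine ⟨π', hπ', fun k => ?_, fun i hi => ?_⟩
    · by_cases hk : k = a.succ
      · subst hk
        rw [← hsnd a, ← hnew, Measure.map_map measurable_snd (by fun_prop)]
        rfl
      · rw [← hmarg k]
        exact hold _ (measurable_pi_apply k) fun ω y => Function.update_of_ne hk _ _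
    · rcases Nat.lt_succ_iff_lt_or_eq.1 hi with hlt | heq
      · rw [← hpair i hlt]
        refine hold _ (by fun_prop) fun ω y => ?_
        have h1 : i.castSucc ≠ a.succ := fun h => by
          simp [a, Fin.ext_iff] at h
          omega
        have h2 : i.succ ≠ a.succ := fun h => by
          simp [a, Fin.ext_iff] at h
          omega
        rw [Function.update_of_ne h1, Function.update_of_ne h2]
      · obtain rfl : i = a := Fin.ext heq
        exact hnew

/-- Fix `μ₀ ∈ P(X₀)` and `μ_K ∈ P(X_K)`. If there exist intermediate
probability measures `μₖ ∈ P(X̂ₖ)` (`k = 1, …, K−1`) such that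
`Σ_{i=0}^{K−1} C̃_{i,i+1}(μᵢ, μ_{i+1}) < ∞`, where `C̃_{i,i+1}` is the two-marginal optimal
transport cost for the maximum adjacent cost `c̃_{i,i+1}`, then the optimal value `M` of the
hierarchical jump multi-marginal transport problem is finite. -/
theorem hjmotValue_lt_top {K : ℕ} (hK : 1 ≤ K)
    (Y : Fin (K + 1) → Type*) [∀ k, TopologicalSpace (Y k)] [∀ k, PolishSpace (Y k)]
    [∀ k, MeasurableSpace (Y k)] [∀ k, BorelSpace (Y k)]
    (D : ∀ k, Set (Y k))
    (hDopen : ∀ k, IsOpen (D k)) (hDsub : ∀ k, (D k).Subsingleton)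
    (hD0 : D 0 = ∅) (hDK : D (Fin.last K) = ∅)
    (c : ∀ i j : Fin (K + 1), Y i → Y j → ℝ≥0∞)
    (hc : ∀ i j : Fin (K + 1), i < j →
      LowerSemicontinuousOn (fun p : Y i × Y j => c i j p.1 p.2) ((D i)ᶜ ×ˢ (D j)ᶜ))
    (μ0 : Measure (Y 0)) (μK : Measure (Y (Fin.last K)))
    [IsProbabilityMeasure μ0] [IsProbabilityMeasure μK]
    (hex : ∃ μ : ∀ k, Measure (Y k), (∀ k, IsProbabilityMeasure (μ k)) ∧
      μ 0 = μ0 ∧ μ (Fin.last K) = μK ∧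
      (∑ i : Fin K, otCost (maxAdjCost D c i) (μ i.castSucc) (μ i.succ)) < ∞) :
    hjmotValue D c μ0 μK < ∞ := by
  obtain ⟨μ, hμ, rfl, rfl, hsum⟩ := hex
  have hcoupling : ∀ i : Fin K, ∃ γ : Measure (Y i.castSucc × Y i.succ),
      γ.map Prod.fst = μ i.castSucc ∧ γ.map Prod.snd = μ i.succ ∧
      ∫⁻ p, maxAdjCost D c i p.1 p.2 ∂γ < ∞ := by
    intro i
    have hi := ENNReal.sum_lt_top.1 hsum i (Finset.mem_univ i)
    simpa only [otCost, iInf_lt_iff, exists_prop] using hi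
  choose γ hfst hsnd hfin using hcoupling
  obtain ⟨π, hπ, hmarg, hpair⟩ := exists_isProbabilityMeasure_map_pair_eq μ γ hfst hsnd
  have hmeas := measurable_maxAdjCost (fun k => (hDopen k).measurableSet) hc
  calc hjmotValue D c (μ 0) (μ (Fin.last K))
      ≤ ∫⁻ ω, pathCost D c ω ∂π :=
        iInf₂_le_of_le π hπ (iInf₂_le_of_le (hmarg 0) (hmarg (Fin.last K)) le_rfl)
    _ ≤ ∫⁻ ω, ∑ i : Fin K, maxAdjCost D c i (ω i.castSucc) (ω i.succ) ∂π :=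
        lintegral_mono fun ω => pathCost_le_sum_maxAdjCost D c ω
    _ = ∑ i : Fin K, ∫⁻ ω, maxAdjCost D c i (ω i.castSucc) (ω i.succ) ∂π :=
        lintegral_finsetSum _ fun i _ => (hmeas i).comp
          (g := fun p : Y i.castSucc × Y i.succ => maxAdjCost D c i p.1 p.2)
          (f := fun ω : ∀ k, Y k => (ω i.castSucc, ω i.succ)) (by fun_prop)
    _ = ∑ i : Fin K, ∫⁻ p, maxAdjCost D c i p.1 p.2 ∂(γ i) := by
        refine Finset.sum_congr rfl fun i _ => ?_
        rw [← hpair i, lintegral_map (hmeas i) (by fun_prop)]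
    _ < ∞ := ENNReal.sum_lt_top.2 fun i _ => hfin i
end
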